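/- Let q = p^e be a power of a prime with q ≡ 1 (mod 6), t = (q-1)/6, ω₆ = ω^t, ω₃ = ω^{2t}, ω₂ = ω^{3t}, and let λ ∈ 𝔽_q with λ ≠ 0 and λ⁶ ≠ 1. For the equivalence class of w = (0,0,1,1,2,2): Σ_{w'∈[0,0,1,1,2,2]} N_q(0,w') + S_{[0,0,1,1,2,2]} = q³·₃F₂(ω₂,ω̄₃,ω̄₆; ω₆,ω₃ | 1/λ⁶)_q. -/

import Mathlib

open scoped Classical

noncomputable section

/-- The Gauss sum `g(χ) = ∑ₓ χ(x) exp(2π√-1 · tr(x)/p)` of a multiplicative character `χ`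
of a finite field `F` of characteristic `p`, where `tr : F → 𝔽_p` is the trace map. -/
def gaussChar (p : ℕ) (F : Type) [Field F] [Fintype F] [Algebra (ZMod p) F]
    (χ : MulChar F ℂ) : ℂ :=
  ∑ x : F, χ x *
    Complex.exp (2 * Real.pi * Complex.I * ((Algebra.trace (ZMod p) F x).val : ℂ) / (p : ℂ))

/-- The Jacobi sum `J(χ₁, …, χₙ) = ∑_{x₁ + ⋯ + xₙ = 1} χ₁(x₁) ⋯ χₙ(xₙ)`. -/
def jacobiS (F : Type) [Field F] [Fintype F] {n : ℕ} (χ : Fin n → MulChar F ℂ) : ℂ :=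
  ∑ v ∈ Finset.univ.filter (fun v : Fin n → F => ∑ i, v i = 1), ∏ i, χ i (v i)

/-- The normalized Jacobi sum `binom(A; B) = (B(-1)/q) · J(A, B̄)`. -/
def gBinom (F : Type) [Field F] [Fintype F] (A B : MulChar F ℂ) : ℂ :=
  B (-1) / (Fintype.card F : ℂ) * jacobiS F ![A, B⁻¹]

/-- Greene's finite-field hypergeometric function `ₙ₊₁Fₙ` (case `n ≥ 2`), where the sum over all
multiplicative characters is written as a sum over the powers `ω^j`, `0 ≤ j ≤ q - 2`, of a fixed
generator `ω` of the character group. -/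
def greeneF (F : Type) [Field F] [Fintype F] (ω : MulChar F ℂ) {n : ℕ}
    (A : Fin (n + 1) → MulChar F ℂ) (B : Fin n → MulChar F ℂ) (x : F) : ℂ :=
  (Fintype.card F : ℂ) / ((Fintype.card F : ℂ) - 1) *
    ∑ j ∈ Finset.range (Fintype.card F - 1),
      gBinom F (A 0 * ω ^ j) (ω ^ j) *
        (∏ i : Fin n, gBinom F (A i.succ * ω ^ j) (B i * ω ^ j)) * (ω ^ j) x

/-- Greene's finite-field hypergeometric function `₂F₁` (case `n = 1`):
`₂F₁(A₀, A₁; B₁ | x) = ε(x) · (A₁B₁(-1)/q) · ∑_y A₁(y) (A̅₁B₁)(1-y) A̅₀(1-xy)`. -/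
def greene2F1 (F : Type) [Field F] [Fintype F] (A₀ A₁ B₁ : MulChar F ℂ) (x : F) : ℂ :=
  (1 : MulChar F ℂ) x * ((A₁ * B₁) (-1) / (Fintype.card F : ℂ)) *
    ∑ y : F, A₁ y * (A₁⁻¹ * B₁) (1 - y) * A₀⁻¹ (1 - x * y)

/-- The number of `F`-rational points of the Dwork hypersurface
`x₁^d + ⋯ + x_d^d = dλ x₁ ⋯ x_d` in projective space. -/
def dworkCount (F : Type) [Field F] [Fintype F] (d : ℕ) (lam : F) : ℕ :=
  Nat.card {P : Projectivization F (Fin d → F) //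
    ∑ i, P.rep i ^ d = (d : F) * lam * ∏ i, P.rep i}

/-- The number of `F`-rational points of the diagonal hypersurface
`x₁^d + ⋯ + xₙ^d = dλ x₁^{h₁} ⋯ xₙ^{hₙ}` in projective space. -/
def diagCount (F : Type) [Field F] [Fintype F] (d n : ℕ) (h : Fin n → ℕ) (lam : F) : ℕ :=
  Nat.card {P : Projectivization F (Fin n → F) //
    ∑ i, P.rep i ^ d = (d : F) * lam * ∏ i, P.rep i ^ h i}

/-- The quantity `N_q(0, w)` from Koblitz's formula, with `t = (q - 1)/d`. -/
def NqW (p : ℕ) (F : Type) [Field F] [Fintype F] [Algebra (ZMod p) F]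
    (ω : MulChar F ℂ) (d : ℕ) {n : ℕ} (w : Fin n → ZMod d) : ℂ :=
  if ∀ i, w i = 0 then ((Fintype.card F : ℂ) ^ (n - 1) - 1) / ((Fintype.card F : ℂ) - 1)
  else if ∀ i, w i ≠ 0 then
    (1 / (Fintype.card F : ℂ)) *
      ∏ i, gaussChar p F (ω ^ ((w i).val * ((Fintype.card F - 1) / d)))
  else 0

/-- The quantity `S_{[w]} = (q-1)⁻¹ ∑_{j=0}^{q-2} (∏ᵢ g(ω^{wᵢt + hᵢj}) / g(ω^{dj})) ω^{dj}(dλ)`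
from Koblitz's formula, with `t = (q - 1)/d`. -/
def SW (p : ℕ) (F : Type) [Field F] [Fintype F] [Algebra (ZMod p) F]
    (ω : MulChar F ℂ) (d : ℕ) {n : ℕ} (h : Fin n → ℕ) (w : Fin n → ZMod d) (lam : F) : ℂ :=
  ((Fintype.card F : ℂ) - 1)⁻¹ *
    ∑ j ∈ Finset.range (Fintype.card F - 1),
      (∏ i, gaussChar p F (ω ^ ((w i).val * ((Fintype.card F - 1) / d) + h i * j))) /
          gaussChar p F (ω ^ (d * j)) * (ω ^ (d * j)) ((d : F) * lam)

end


section HD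
variable {F : Type} [Field F] [Fintype F]

lemma hd_gauss_ne_zero {e : AddChar F ℂ} (he : e.IsPrimitive) (he1 : e ≠ 1) (χ : MulChar F ℂ) :
    gaussSum χ e ≠ 0 := by
  by_cases h : χ = 1
  · subst h; rw [gaussSum_one_left he1]; norm_num
  · exact gaussSum_ne_zero_of_nontrivial (by simp) h he

lemma hd_gauss_inv {e : AddChar F ℂ} (he : e.IsPrimitive) {χ : MulChar F ℂ} (h : χ ≠ 1) :
    gaussSum χ e * gaussSum χ⁻¹ e = χ (-1) * Fintype.card F := by
  rw [← gaussSum_mul_gaussSum_eq_card h he, ← mul_gaussSum_inv_eq_gaussSum χ⁻¹ e,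
    MulChar.inv_apply', inv_neg, inv_one]
  ring

lemma hd_gauss_norm {e : AddChar F ℂ} (he : e.IsPrimitive) {χ : MulChar F ℂ} (h : χ ≠ 1) :
    ‖gaussSum χ e‖ ^ 2 = Fintype.card F := by
  have h1 := gaussSum_mul_gaussSum_eq_card h he
  rw [← star_gaussSum_eq] at h1
  have h2 : gaussSum χ e * star (gaussSum χ e) = ((‖gaussSum χ e‖ ^ 2 : ℝ) : ℂ) := by
    rw [← starRingEnd_apply, Complex.mul_conj, Complex.normSq_eq_norm_sq]
  rw [h2] at h1
  exact_mod_cast h1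

/-- Quadratic characters count square roots. -/
lemma hd_quad_eq {η : MulChar F ℂ} (h2 : (2 : F) ≠ 0) (hη : η ≠ 1) (hη2 : η ^ 2 = 1) (v : F) :
    η v = (quadraticChar F v : ℂ) := by
  have hF : ringChar F ≠ 2 := by
    intro h
    apply h2
    have := ringChar.Nat.cast_ringChar (R := F)
    rw [h] at this
    exact_mod_cast this
  have hsq : ∀ a : F, a ≠ 0 → η a = 1 ∨ η a = -1 := by
    intro a ha
    have : η a ^ 2 = 1 := by
      rw [← MulChar.pow_apply' _ (by norm_num), hη2, MulChar.one_apply (isUnit_iff_ne_zero.mpr ha)]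
    simpa using this
  have hs : ∀ a : F, a ≠ 0 → quadraticChar F a = 1 → η a = 1 := by
    intro a ha h
    obtain ⟨s, rfl⟩ := (quadraticChar_one_iff_isSquare ha).mp h
    rw [map_mul]
    rcases hsq s (by rintro rfl; simp at ha) with h | h <;> rw [h] <;> norm_num
  by_cases hv : v = 0
  · subst hv; rw [MulChar.map_zero, MulChar.map_zero]; simp
  obtain ⟨a, ha⟩ := MulChar.ne_one_iff.mp hη
  have ha1 : η a = -1 := (hsq a a.ne_zero).resolve_left ha
  have ha2 : quadraticChar F (a : F) = -1 :=
    (quadraticChar_dichotomy a.ne_zero).resolve_left (fun h => ha (hs a a.ne_zero h))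
  rcases quadraticChar_dichotomy hv with h | h
  · rw [h, hs v hv h]; simp
  · have := hs (a * v) (mul_ne_zero a.ne_zero hv) (by rw [map_mul, ha2, h]; norm_num)
    rw [map_mul, ha1] at this
    rw [h]; push_cast; linear_combination -this

lemma hd_sum_sq {η : MulChar F ℂ} (h2 : (2 : F) ≠ 0) (hη : η ≠ 1) (hη2 : η ^ 2 = 1) (f : F → ℂ) :
    ∑ u : F, f (u ^ 2) = ∑ v : F, (1 + η v) * f v := by
  have hF : ringChar F ≠ 2 := by
    intro h
    apply h2
    have := ringChar.Nat.cast_ringChar (R := F)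
    rw [h] at this
    exact_mod_cast this
  rw [← Finset.sum_fiberwise Finset.univ (fun u : F => u ^ 2)]
  refine Finset.sum_congr rfl fun v _ => ?_
  rw [Finset.sum_congr rfl (g := fun _ => f v) (by
    intro x hx; rw [(Finset.mem_filter.mp hx).2]), Finset.sum_const, nsmul_eq_mul]
  congr 1
  have := quadraticChar_card_sqrts hF v
  rw [hd_quad_eq h2 hη hη2]
  have h3 : {x : F | x ^ 2 = v}.toFinset = Finset.univ.filter (fun x : F => x ^ 2 = v) := by
    ext; simp
  rw [h3] at this
  have h4 := congrArg (fun z : ℤ => (z : ℂ)) this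
  push_cast at h4
  rw [h4]; ring

/-- Hasse-Davenport product formula for `m = 2`. -/
lemma hd_two {e : AddChar F ℂ} (he : e.IsPrimitive) (he1 : e ≠ 1) (h2 : (2 : F) ≠ 0)
    {η : MulChar F ℂ} (hη : η ≠ 1) (hη2 : η ^ 2 = 1) (h4 : ∀ ψ : MulChar F ℂ, ψ ^ 2 = 1 → ψ = 1 ∨ ψ = η)
    (ψ : MulChar F ℂ) :
    ψ 4 * (gaussSum ψ e * gaussSum (ψ * η) e) = gaussSum (ψ ^ 2) e * gaussSum η e := by
  have h40 : (4 : F) ≠ 0 := by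
    have : (4 : F) = 2 * 2 := by norm_num
    rw [this]; exact mul_ne_zero h2 h2
  by_cases hψ : ψ ^ 2 = 1
  · rcases h4 ψ hψ with rfl | rfl
    · rw [MulChar.one_apply (isUnit_iff_ne_zero.mpr h40)]; simp
    · have h5 : ψ 4 = 1 := by
        have : (4 : F) = 2 ^ 2 := by norm_num
        rw [this, map_pow, ← MulChar.pow_apply' _ (by norm_num), hη2,
          MulChar.one_apply (isUnit_iff_ne_zero.mpr h2)]
      rw [h5, ← pow_two, hη2]; ring
  · have hne : ψ * η ≠ 1 := by
      intro h
      have : ψ = η⁻¹ := eq_inv_of_mul_eq_one_left h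
      apply hψ; rw [this, inv_pow, hη2, inv_one]
    have hψ1 : ψ ≠ 1 := by rintro rfl; simp at hψ
    have e1 := jacobiSum_mul_nontrivial (χ := ψ) (φ := ψ) (by rwa [← pow_two]) e
    have e2 := jacobiSum_mul_nontrivial hne e
    have e3 : ψ 4 * jacobiSum ψ ψ = jacobiSum ψ η := by
      rw [jacobiSum_comm ψ η]
      have : ψ 4 * jacobiSum ψ ψ = ∑ x : F, ψ (1 - (1 - 2 * x) ^ 2) := by
        rw [jacobiSum, Finset.mul_sum]
        refine Finset.sum_congr rfl fun x _ => ?_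
        rw [← map_mul, ← map_mul]; congr 1; ring
      rw [this]
      have hb : Function.Bijective (fun x : F => 1 - 2 * x) :=
        (Finite.injective_iff_bijective).mp (fun a b hab => by
          simp only [sub_right_inj] at hab
          exact mul_left_cancel₀ h2 hab)
      rw [hb.sum_comp (fun u => ψ (1 - u ^ 2)), hd_sum_sq h2 hη hη2 (fun v => ψ (1 - v))]
      simp only [add_mul, one_mul, Finset.sum_add_distrib]
      have : ∑ x : F, ψ (1 - x) = 0 := by
        exact ((Equiv.subLeft (1 : F)).sum_comp ψ).trans (MulChar.sum_eq_zero_of_ne_one hψ1)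
      rw [this, zero_add, jacobiSum]
    have n1 := hd_gauss_ne_zero he he1 ψ
    have : gaussSum ψ e * (ψ 4 * (gaussSum ψ e * gaussSum (ψ * η) e)) =
        gaussSum ψ e * (gaussSum (ψ ^ 2) e * gaussSum η e) := by
      rw [pow_two]
      linear_combination (- ψ 4 * gaussSum (ψ * η) e) * e1 + gaussSum (ψ * ψ) e * gaussSum (ψ * η) e * e3 + gaussSum (ψ * ψ) e * e2
    exact mul_left_cancel₀ n1 this

/-- triple Jacobi sum -/
noncomputable def hdJ (s : F) (a b c : MulChar F ℂ) : ℂ := ∑ y : F, ∑ z : F, a (s - y - z) * b y * c z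

lemma hdJ_scale (s u : F) (hu : u ≠ 0) (a b c : MulChar F ℂ) :
    hdJ (u * s) a b c = (a * b * c) u * hdJ s a b c := by
  unfold hdJ
  rw [← Equiv.sum_comp (Equiv.mulLeft₀ u hu), Finset.mul_sum]
  refine Finset.sum_congr rfl fun y _ => ?_
  rw [← Equiv.sum_comp (Equiv.mulLeft₀ u hu), Finset.mul_sum]
  refine Finset.sum_congr rfl fun z _ => ?_
  simp only [Equiv.mulLeft₀_apply, MulChar.mul_apply]
  rw [show u * s - u * y - u * z = u * (s - y - z) by ring, map_mul, map_mul, map_mul]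
  ring

lemma hd_gauss3 (e : AddChar F ℂ) (a b c : MulChar F ℂ) :
    gaussSum a e * gaussSum b e * gaussSum c e =
      gaussSum (a * b * c) e * hdJ 1 a b c + hdJ 0 a b c := by
  have h1 : gaussSum a e * gaussSum b e * gaussSum c e = ∑ s : F, hdJ s a b c * e s := by
    have : ∀ y z : F, gaussSum a e * (b y * e y) * (c z * e z)
        = ∑ s : F, a (s - y - z) * b y * c z * e s := by
      intro y z
      rw [gaussSum, ← ((Equiv.subRight (y + z)).sum_comp), Finset.sum_mul, Finset.sum_mul]
      refine Finset.sum_congr rfl fun s _ => ?_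
      simp only [Equiv.subRight_apply]
      have : e s = e (s - (y + z)) * e y * e z := by
        rw [← AddChar.map_add_eq_mul, ← AddChar.map_add_eq_mul]; congr 1; ring
      rw [this, sub_sub]; ring
    conv_lhs => rw [gaussSum, gaussSum.eq_1 b, gaussSum.eq_1 c]
    rw [← gaussSum]
    simp_rw [Finset.mul_sum, Finset.sum_mul, this, hdJ, Finset.sum_mul]
    rw [Finset.sum_comm]
    conv_rhs => rw [Finset.sum_comm]
    refine Finset.sum_congr rfl fun y _ => ?_
    rw [Finset.sum_comm]
  rw [h1, gaussSum, Finset.sum_mul]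
  rw [← Finset.add_sum_erase _ _ (Finset.mem_univ (0 : F)),
    ← Finset.add_sum_erase (a := (0 : F)) Finset.univ (fun x => (a * b * c) x * e x * hdJ 1 a b c) (Finset.mem_univ (0 : F))]
  rw [MulChar.map_zero, AddChar.map_zero_eq_one]
  have : ∀ s ∈ Finset.univ.erase (0 : F), hdJ s a b c * e s = (a * b * c) s * e s * hdJ 1 a b c := by
    intro s hs
    have := hdJ_scale 1 s (Finset.ne_of_mem_erase hs) a b c
    rw [mul_one] at this
    rw [this]; ring
  rw [Finset.sum_congr rfl this]; ring

lemma hdJ_zero {a b c : MulChar F ℂ} (h : a * b * c ≠ 1) : hdJ 0 a b c = 0 := by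
  obtain ⟨u, hu⟩ := MulChar.ne_one_iff.mp h
  have := hdJ_scale 0 (u : F) u.ne_zero a b c
  rw [mul_zero] at this
  by_contra hne
  apply hu
  field_simp at this
  exact this.symm

lemma hdJ_one {e : AddChar F ℂ} (he1 : e ≠ 1) {a b c : MulChar F ℂ} (h : a * b * c = 1)
    (hb : a ≠ 1 ∨ b ≠ 1 ∨ c ≠ 1) :
    gaussSum a e * gaussSum b e * gaussSum c e = - Fintype.card F * hdJ 1 a b c := by
  have h1 := hd_gauss3 e a b c
  have h2 := hd_gauss3 1 a b c
  rw [h, gaussSum_one_left he1] at h1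
  rw [h, gaussSum_one_one] at h2
  have h3 : gaussSum a 1 * gaussSum b 1 * gaussSum c 1 = 0 := by
    rcases hb with h | h | h <;> rw [gaussSum_one_right h] <;> ring
  rw [h3, Nat.card_units, Nat.card_eq_fintype_card, Nat.cast_sub Fintype.card_pos] at h2
  push_cast at h2
  rw [h1]; linear_combination -h2

noncomputable instance hdFintype : Fintype (MulChar F ℂ) := Fintype.ofFinite _

lemma hd_orth (a : F) : ∑ ψ : MulChar F ℂ, ψ a = if a = 1 then ((Fintype.card F : ℂ) - 1) else 0 := by
  split_ifs with h
  · subst h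
    simp only [MulChar.map_one, Finset.sum_const, Finset.card_univ, nsmul_eq_mul, mul_one]
    rw [← Nat.card_eq_fintype_card, MulChar.card_eq_card_units_of_hasEnoughRootsOfUnity,
      Nat.card_units, Nat.card_eq_fintype_card, Nat.cast_sub Fintype.card_pos]
    simp
  · obtain ⟨χ, hχ⟩ := MulChar.exists_apply_ne_one_of_hasEnoughRootsOfUnity F ℂ h
    have : ∑ ψ : MulChar F ℂ, ψ a = χ a * ∑ ψ : MulChar F ℂ, ψ a := by
      conv_lhs => rw [← Equiv.sum_comp (Equiv.mulLeft χ)]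
      rw [Finset.mul_sum]; rfl
    by_contra hne
    apply hχ
    field_simp at this
    exact this.symm

lemma hd_node {χ : MulChar F ℂ} (hχ : χ ^ 3 = 1) (h3 : (3 : F) ≠ 0) (ζ : F) (hζ : ζ ^ 2 + ζ + 1 = 0) :
    ∑ y : F, ∑ z : F, (if 27 * ((1 - y - z) * y * z) = 1 then χ y * χ⁻¹ z else 0) =
      (Fintype.card F : ℂ) - 3 := by
  rw [← Finset.sum_product' Finset.univ Finset.univ
    (fun y z : F => (if 27 * ((1 - y - z) * y * z) = 1 then χ y * χ⁻¹ z else 0)),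
    ← Finset.sum_filter]
  have hcube : ∀ r : F, r ≠ 0 → χ r ^ 3 = 1 := by
    intro r hr
    rw [← MulChar.pow_apply' _ (by norm_num), hχ, MulChar.one_apply (isUnit_iff_ne_zero.mpr hr)]
  set P := ((Finset.univ : Finset F) ×ˢ (Finset.univ : Finset F)).filter
    (fun x => 27 * ((1 - x.1 - x.2) * x.1 * x.2) = 1) with hP
  have hmem : ((1 / 3, 1 / 3) : F × F) ∈ P := by
    simp only [hP, Finset.mem_filter, Finset.mem_product, Finset.mem_univ, true_and]
    field_simp; norm_num
  rw [← Finset.add_sum_erase _ _ hmem]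
  set R : Finset F := Finset.univ \ {0, -1, ζ, -1 - ζ} with hR
  have hz0 : ζ ≠ 0 := by rintro rfl; simp at hζ
  have hz1 : ζ ≠ -1 := by rintro rfl; simp at hζ
  have hz2 : ζ ≠ -1 - ζ := by
    intro h; apply h3
    linear_combination 4 * hζ - (2 * ζ + 1) * h
  have hcard : (R.card : ℂ) = (Fintype.card F : ℂ) - 4 := by
    have h4 : ({0, -1, ζ, -1 - ζ} : Finset F).card = 4 := by
      rw [Finset.card_insert_of_notMem, Finset.card_insert_of_notMem, Finset.card_insert_of_notMem,
        Finset.card_singleton]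
      · simpa using hz2
      · simp only [Finset.mem_insert, Finset.mem_singleton, not_or]
        refine ⟨fun h => hz1 h.symm, fun h => hz0 (by linear_combination h)⟩
      · simp only [Finset.mem_insert, Finset.mem_singleton, not_or]
        refine ⟨by norm_num, fun h => hz0 h.symm, fun h => hz1 (by linear_combination h)⟩
    rw [hR, Finset.card_sdiff_of_subset (Finset.subset_univ _), h4, Nat.cast_sub]
    · simp
    · rw [← h4]; exact Finset.card_le_card (Finset.subset_univ _)
  have hRmem : ∀ r, r ∈ R ↔ r ≠ 0 ∧ r + 1 ≠ 0 ∧ r ^ 2 + r + 1 ≠ 0 := by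
    intro r
    simp only [hR, Finset.mem_sdiff, Finset.mem_univ, true_and, Finset.mem_insert,
      Finset.mem_singleton, not_or]
    have : r ^ 2 + r + 1 = (r - ζ) * (r - (-1 - ζ)) := by linear_combination hζ
    rw [this, mul_ne_zero_iff, sub_ne_zero, sub_ne_zero, ← sub_neg_eq_add r 1, sub_ne_zero]
  have hmain : ∑ x ∈ P.erase (1 / 3, 1 / 3), χ x.1 * χ⁻¹ x.2 = ∑ r ∈ R, (1 : ℂ) := by
    have key : ∀ y z : F, (y, z) ∈ P.erase (1 / 3, 1 / 3) →
        27 * ((1 - y - z) * y * z) = 1 ∧ 1 - 3 * z ≠ 0 := by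
      intro y z h
      obtain ⟨hne, hm⟩ := Finset.mem_erase.mp h
      simp only [hP, Finset.mem_filter, Finset.mem_product, Finset.mem_univ, true_and] at hm
      refine ⟨hm, fun h0 => hne ?_⟩
      have hz : z = 1 / 3 := by field_simp; linear_combination -h0
      have hy : (1 - 3 * y) ^ 2 = 0 := by
        linear_combination -hm + (9 * y ^ 2 - 6 * y + 9 * y * z) * h0
      have hy' : y = 1 / 3 := by
        field_simp; linear_combination - (pow_eq_zero_iff (two_ne_zero)).mp hy
      rw [hz, hy']
    have key2 : ∀ y z : F, (y, z) ∈ P.erase (1 / 3, 1 / 3) →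
        3 * ((1 - 3 * y) / (1 - 3 * z)) * ((1 - 3 * y) / (1 - 3 * z) + 1) * z = -1 ∧
        3 * ((1 - 3 * y) / (1 - 3 * z) + 1) * y = - ((1 - 3 * y) / (1 - 3 * z)) ^ 2 := by
      intro y z h
      obtain ⟨hm, hn⟩ := key y z h
      constructor
      · field_simp; linear_combination -hm
      · field_simp; linear_combination -hm
    refine Finset.sum_bij' (fun x _ => (1 - 3 * x.1) / (1 - 3 * x.2))
      (fun r _ => (- r ^ 2 / (3 * (r + 1)), - 1 / (3 * r * (r + 1)))) ?_ ?_ ?_ ?_ ?_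
    · rintro ⟨y, z⟩ h
      obtain ⟨k1, k2⟩ := key2 y z h
      obtain ⟨hm, hn⟩ := key y z h
      rw [hRmem]
      dsimp only at *
      set r := (1 - 3 * y) / (1 - 3 * z)
      refine ⟨?_, ?_, ?_⟩
      · intro h; rw [h] at k1; simp at k1
      · intro h; rw [h] at k1; simp at k1
      · intro h; apply hn; linear_combination k1 - 3 * z * h
    · intro r h
      obtain ⟨r0, r1, r2⟩ := (hRmem r).mp h
      refine Finset.mem_erase.mpr ⟨?_, ?_⟩
      · intro h
        have := congrArg Prod.snd h
        simp only at this
        apply r2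
        field_simp at this
        linear_combination -this
      · simp only [hP, Finset.mem_filter, Finset.mem_product, Finset.mem_univ, true_and]
        field_simp
        ring
    · rintro ⟨y, z⟩ h
      obtain ⟨k1, k2⟩ := key2 y z h
      dsimp only
      set r := (1 - 3 * y) / (1 - 3 * z)
      have r0 : r ≠ 0 := by intro h; rw [h] at k1; simp at k1
      have r1 : r + 1 ≠ 0 := by intro h; rw [h] at k1; simp at k1
      ext
      · dsimp only; field_simp; linear_combination -k2
      · dsimp only; field_simp; linear_combination -k1
    · intro r h
      obtain ⟨r0, r1, r2⟩ := (hRmem r).mp h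
      dsimp only
      have q1 : 1 - 3 * (- r ^ 2 / (3 * (r + 1))) = (r ^ 2 + r + 1) / (r + 1) := by
        field_simp; ring
      have q2 : 1 - 3 * (-1 / (3 * r * (r + 1))) = (r ^ 2 + r + 1) / (r * (r + 1)) := by
        field_simp; ring
      rw [q1, q2, div_div_div_eq, div_eq_iff (mul_ne_zero r1 r2)]; ring
    · rintro ⟨y, z⟩ h
      obtain ⟨k1, k2⟩ := key2 y z h
      dsimp only
      set r := (1 - 3 * y) / (1 - 3 * z)
      have r0 : r ≠ 0 := by intro h; rw [h] at k1; simp at k1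
      have r1 : r + 1 ≠ 0 := by intro h; rw [h] at k1; simp at k1
      have z0 : z ≠ 0 := by intro h; rw [h] at k1; simp at k1
      have : y * z⁻¹ = r ^ 3 := by
        field_simp
        apply mul_left_cancel₀ (mul_ne_zero h3 r1)
        linear_combination k2 - r ^ 2 * k1
      rw [MulChar.inv_apply', ← map_mul, this, map_pow, hcube r r0]
  rw [hmain, Finset.sum_const, nsmul_eq_mul, hcard]
  have : χ (1 / 3) * χ⁻¹ (1 / 3) = 1 := by
    rw [← MulChar.mul_apply, mul_inv_cancel, MulChar.one_apply (isUnit_iff_ne_zero.mpr (one_div_ne_zero h3))]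
  rw [this]; ring

lemma hd_extremal {ι : Type} (s : Finset ι) (z : ι → ℂ) (r : ℝ) (hz : ∀ i ∈ s, ‖z i‖ = r)
    (hs : ∑ i ∈ s, z i = s.card * r) : ∀ i ∈ s, z i = r := by
  have h0 : ∑ i ∈ s, (r - (z i).re) = 0 := by
    rw [Finset.sum_sub_distrib, ← Complex.re_sum, hs]; simp
  have h1 := (Finset.sum_eq_zero_iff_of_nonneg (fun i hi => by
    rw [← hz i hi]; exact sub_nonneg.mpr (Complex.re_le_norm _))).mp h0
  intro i hi
  have h2 : (z i).re = ‖z i‖ := by rw [hz i hi]; linarith [h1 i hi]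
  have h3 := (Complex.re_eq_norm).mp h2
  rw [← hz i hi]
  exact Complex.eq_coe_norm_of_nonneg h3

/-- Hasse-Davenport product formula for `m = 3`. -/
lemma hd_three {e : AddChar F ℂ} (he : e.IsPrimitive) (he1 : e ≠ 1) (h3 : (3 : F) ≠ 0)
    (ζ : F) (hζ : ζ ^ 2 + ζ + 1 = 0)
    {χ : MulChar F ℂ} (hχ : χ ≠ 1) (hχ3 : χ ^ 3 = 1)
    (hc : ∀ ψ : MulChar F ℂ, ψ ^ 3 = 1 → ψ = 1 ∨ ψ = χ ∨ ψ = χ ^ 2)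
    (ψ : MulChar F ℂ) :
    ψ 27 * (gaussSum ψ e * gaussSum (ψ * χ) e * gaussSum (ψ * χ ^ 2) e) =
      gaussSum (ψ ^ 3) e * Fintype.card F := by
  have hq0 : (Fintype.card F : ℂ) ≠ 0 := by simp
  have hinv : χ⁻¹ = χ ^ 2 := by
    rw [inv_eq_iff_mul_eq_one, ← pow_succ', hχ3]
  have h270 : IsUnit (27 : F) := by
    have : (27 : F) = 3 ^ 3 := by norm_num
    rw [this]; exact isUnit_iff_ne_zero.mpr (pow_ne_zero _ h3)
  have hχ27 : χ 27 = 1 := by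
    have : (27 : F) = 3 ^ 3 := by norm_num
    rw [this, map_pow, ← MulChar.pow_apply' _ (by norm_num), hχ3,
      MulChar.one_apply (isUnit_iff_ne_zero.mpr h3)]
  have hχm : χ (-1) = 1 := MulChar.val_neg_one_eq_one_of_odd_order (n := 3) (by decide) hχ3
  have hχ4 : χ ^ 2 * χ ^ 2 = χ := by rw [← pow_add, show 2 + 2 = 3 + 1 by rfl, pow_add, hχ3]; simp
  have hprod : ∀ ψ : MulChar F ℂ, ψ * (ψ * χ) * (ψ * χ ^ 2) = ψ ^ 3 := by
    intro ψ
    have : ψ * (ψ * χ) * (ψ * χ ^ 2) = ψ ^ 3 * χ ^ 3 := by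
      rw [pow_succ ψ 2, pow_two ψ, pow_succ χ 2]
      simp only [mul_assoc, mul_comm, mul_left_comm]
    rw [this, hχ3, mul_one]
  have hsmall : ∀ ψ : MulChar F ℂ, ψ ^ 3 = 1 → ψ 27 = 1 ∧
      gaussSum ψ e * gaussSum (ψ * χ) e * gaussSum (ψ * χ ^ 2) e = - Fintype.card F := by
    have hgg := hd_gauss_inv he hχ
    rw [hinv, hχm, one_mul] at hgg
    have hχχ : χ * χ ^ 2 = 1 := by rw [← pow_succ', hχ3]
    intro ψ h
    rcases hc ψ h with rfl | rfl | rfl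
    · rw [MulChar.one_apply h270, one_mul, one_mul, gaussSum_one_left he1]
      exact ⟨rfl, by linear_combination -hgg⟩
    · refine ⟨hχ27, ?_⟩
      rw [← pow_two, hχχ, gaussSum_one_left he1]; linear_combination -hgg
    · refine ⟨by rw [MulChar.pow_apply' _ (by norm_num), hχ27]; norm_num, ?_⟩
      rw [mul_comm (χ ^ 2) χ, hχχ, hχ4, gaussSum_one_left he1]; linear_combination -hgg
  by_cases hψ : ψ ^ 3 = 1
  · obtain ⟨h1, h2⟩ := hsmall ψ hψ
    rw [h1, h2, hψ, gaussSum_one_left he1]; ring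
  -- the sum over all characters
  have hsum : ∑ ψ : MulChar F ℂ, ψ 27 * hdJ 1 ψ (ψ * χ) (ψ * χ ^ 2) =
      ((Fintype.card F : ℂ) - 1) * ((Fintype.card F : ℂ) - 3) := by
    rw [← hd_node hχ3 h3 ζ hζ]
    simp_rw [hdJ, Finset.mul_sum]
    rw [Finset.sum_comm]
    refine Finset.sum_congr rfl fun y _ => ?_
    rw [Finset.sum_comm]
    refine Finset.sum_congr rfl fun z _ => ?_
    have : ∀ ψ : MulChar F ℂ, ψ 27 * (ψ (1 - y - z) * (ψ * χ) y * (ψ * χ ^ 2) z) =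
        ψ (27 * ((1 - y - z) * y * z)) * (χ y * χ⁻¹ z) := by
      intro ψ
      rw [hinv]
      simp only [map_mul, MulChar.mul_apply]; ring
    simp_rw [this]
    rw [← Finset.sum_mul, hd_orth]
    split_ifs <;> ring
  have hJ1 : ∀ ψ : MulChar F ℂ, ψ ^ 3 = 1 → ψ 27 * hdJ 1 ψ (ψ * χ) (ψ * χ ^ 2) = 1 := by
    intro ψ h
    obtain ⟨h1, h2⟩ := hsmall ψ h
    have := hdJ_one he1 (a := ψ) (b := ψ * χ) (c := ψ * χ ^ 2) (by rw [hprod, h]) (by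
      by_contra hcon
      push Not at hcon
      apply hχ
      have := hcon.2.1
      rwa [hcon.1, one_mul] at this)
    rw [h2] at this
    rw [h1, one_mul]
    apply mul_left_cancel₀ hq0
    linear_combination this
  have hJ2 : ∀ ψ : MulChar F ℂ, ψ ^ 3 ≠ 1 → gaussSum ψ e * gaussSum (ψ * χ) e * gaussSum (ψ * χ ^ 2) e =
      gaussSum (ψ ^ 3) e * hdJ 1 ψ (ψ * χ) (ψ * χ ^ 2) := by
    intro ψ h
    rw [hd_gauss3, hprod, hdJ_zero (by rwa [hprod]), add_zero]
  have hnorm : ∀ ψ : MulChar F ℂ, ψ ^ 3 ≠ 1 →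
      ‖ψ 27 * hdJ 1 ψ (ψ * χ) (ψ * χ ^ 2)‖ = (Fintype.card F : ℝ) := by
    intro ψ h
    have n0 : ψ ≠ 1 := by rintro rfl; simp at h
    have n1 : ψ * χ ≠ 1 := by
      intro h'; apply h
      have : (ψ * χ) ^ 3 = 1 := by rw [h', one_pow]
      rwa [mul_pow, hχ3, mul_one] at this
    have n2 : ψ * χ ^ 2 ≠ 1 := by
      intro h'; apply h
      have : (ψ * χ ^ 2) ^ 3 = 1 := by rw [h', one_pow]
      rwa [mul_pow, ← pow_mul, mul_comm 2 3, pow_mul, hχ3, one_pow, mul_one] at this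
    have h27 : ‖ψ 27‖ = 1 := by
      have : ψ 27 ^ (Fintype.card Fˣ) = 1 := by
        rw [← MulChar.pow_apply' _ Fintype.card_ne_zero, MulChar.pow_card_eq_one, MulChar.one_apply h270]
      exact Complex.norm_eq_one_of_pow_eq_one this Fintype.card_ne_zero
    rw [norm_mul, h27, one_mul]
    have hh := congrArg (fun z : ℂ => ‖z‖ ^ 2) (hJ2 ψ h)
    simp only [norm_mul, mul_pow, hd_gauss_norm he n0, hd_gauss_norm he n1, hd_gauss_norm he n2,
      hd_gauss_norm he h] at hh
    have hqr : (0 : ℝ) < Fintype.card F := by exact_mod_cast Fintype.card_pos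
    rw [← sq_eq_sq₀ (norm_nonneg _) hqr.le]
    apply mul_left_cancel₀ hqr.ne'
    linear_combination -hh
  have hset : Finset.univ.filter (fun ψ : MulChar F ℂ => ψ ^ 3 = 1) = {1, χ, χ ^ 2} := by
    ext ψ
    simp only [Finset.mem_filter, Finset.mem_univ, true_and, Finset.mem_insert, Finset.mem_singleton]
    refine ⟨hc ψ, ?_⟩
    rintro (rfl | rfl | rfl)
    · simp
    · exact hχ3
    · rw [← pow_mul, mul_comm 2 3, pow_mul, hχ3, one_pow]
  have hcard3 : ({1, χ, χ ^ 2} : Finset (MulChar F ℂ)).card = 3 := by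
    have k2 : χ ^ 2 ≠ 1 := by
      rw [← hinv]; simpa using hχ
    rw [Finset.card_insert_of_notMem, Finset.card_insert_of_notMem, Finset.card_singleton]
    · rw [Finset.mem_singleton]; intro h
      apply hχ
      have : χ * 1 = χ * χ := by rw [mul_one, ← pow_two]; exact h
      exact (mul_left_cancel this).symm
    · simp only [Finset.mem_insert, Finset.mem_singleton, not_or]
      exact ⟨hχ.symm, k2.symm⟩
  have hcardall : (Fintype.card (MulChar F ℂ) : ℂ) = (Fintype.card F : ℂ) - 1 := by
    have := hd_orth (1 : F)
    simpa using this
  have hsplit := Finset.sum_filter_add_sum_filter_not Finset.univ (fun ψ : MulChar F ℂ => ψ ^ 3 = 1)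
    (fun ψ => ψ 27 * hdJ 1 ψ (ψ * χ) (ψ * χ ^ 2))
  have hcs := Finset.card_filter_add_card_filter_not (s := Finset.univ) (fun ψ : MulChar F ℂ => ψ ^ 3 = 1)
  rw [hset, hcard3, Finset.card_univ] at hcs
  have hcs' := congrArg (fun n : ℕ => (n : ℂ)) hcs
  push_cast at hcs'
  rw [hcardall] at hcs'
  rw [hsum, Finset.sum_congr rfl (g := fun _ => (1 : ℂ)) (by
    intro x hx; exact hJ1 x (Finset.mem_filter.mp hx).2), hset, Finset.sum_const, hcard3] at hsplit
  have hfin := hd_extremal (Finset.univ.filter (fun ψ : MulChar F ℂ => ¬ ψ ^ 3 = 1))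
    (fun ψ => ψ 27 * hdJ 1 ψ (ψ * χ) (ψ * χ ^ 2)) (Fintype.card F : ℝ)
    (by intro i hi; exact hnorm i (Finset.mem_filter.mp hi).2)
    (by
      push_cast
      simp only [nsmul_eq_mul, mul_one] at hsplit
      push_cast at hsplit
      linear_combination hsplit - (Fintype.card F : ℂ) * hcs')
    ψ (by simpa using hψ)
  rw [hJ2 ψ hψ]
  push_cast at hfin
  linear_combination gaussSum (ψ ^ 3) e * hfin

end HD


section Main
variable {F : Type} [Field F] [Fintype F]

noncomputable def hdAdd (p : ℕ) [Fact p.Prime] (F : Type) [Field F] [Algebra (ZMod p) F] :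
    AddChar F ℂ :=
  (ZMod.stdAddChar (N := p)).compAddMonoidHom (Algebra.trace (ZMod p) F).toAddMonoidHom

lemma hdAdd_apply (p : ℕ) [Fact p.Prime] [Algebra (ZMod p) F] (x : F) :
    hdAdd p F x =
    Complex.exp (2 * Real.pi * Complex.I * ((Algebra.trace (ZMod p) F x).val : ℂ) / (p : ℂ)) := by
  have h : hdAdd p F x = ZMod.stdAddChar (Algebra.trace (ZMod p) F x) := rfl
  rw [h]
  conv_lhs => rw [← ZMod.natCast_zmod_val (Algebra.trace (ZMod p) F x)]
  have := ZMod.stdAddChar_coe (N := p) ((Algebra.trace (ZMod p) F x).val : ℤ)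
  push_cast at this
  rw [this]

lemma hdAdd_ne (p : ℕ) [Fact p.Prime] [Algebra (ZMod p) F] : hdAdd p F ≠ 1 := by
  intro h
  obtain ⟨x, hx⟩ := Algebra.trace_surjective (ZMod p) F 1
  have h1 : ZMod.stdAddChar (N := p) 1 = ZMod.stdAddChar (N := p) 0 := by
    rw [← hx, AddChar.map_zero_eq_one]
    have : hdAdd p F x = 1 := by rw [h]; rfl
    exact this
  exact one_ne_zero (ZMod.injective_stdAddChar h1)

lemma hd_gaussChar (p : ℕ) [Fact p.Prime] [Algebra (ZMod p) F] (χ : MulChar F ℂ) :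
    gaussChar p F χ = gaussSum χ (hdAdd p F) := by
  simp only [gaussChar, gaussSum, hdAdd_apply]

lemma hd_jacobiS (A B : MulChar F ℂ) : jacobiS F ![A, B] = jacobiSum A B := by
  unfold jacobiS jacobiSum
  refine Finset.sum_bij' (fun v _ => v 0) (fun x _ => ![x, 1 - x]) ?_ ?_ ?_ ?_ ?_
  · simp
  · simp
  · intro v hv
    have h := (Finset.mem_filter.mp hv).2
    rw [Fin.sum_univ_two] at h
    ext i; fin_cases i
    · rfl
    · change 1 - v 0 = v 1
      linear_combination -h
  · simp
  · intro v hv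
    have h := (Finset.mem_filter.mp hv).2
    rw [Fin.sum_univ_two] at h
    rw [Fin.prod_univ_two]
    have : 1 - v 0 = v 1 := by linear_combination -h
    simp [this]

lemma hd_orderOf {ω : MulChar F ℂ} (hω : ∀ χ : MulChar F ℂ, ∃ j : ℕ, χ = ω ^ j) :
    orderOf ω = Fintype.card F - 1 := by
  rw [orderOf_eq_card_of_forall_mem_zpowers (fun χ => by
    obtain ⟨j, rfl⟩ := hω χ; exact Subgroup.npow_mem_zpowers ω j),
    MulChar.card_eq_card_units_of_hasEnoughRootsOfUnity, Nat.card_units, Nat.card_eq_fintype_card]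

lemma hd_sum_range {ω : MulChar F ℂ} (hω : ∀ χ : MulChar F ℂ, ∃ j : ℕ, χ = ω ^ j)
    (f : MulChar F ℂ → ℂ) :
    ∑ j ∈ Finset.range (Fintype.card F - 1), f (ω ^ j) = ∑ χ : MulChar F ℂ, f χ := by
  have ho := hd_orderOf hω
  have hpos : 0 < Fintype.card F - 1 := by have := Fintype.one_lt_card (α := F); omega
  refine Finset.sum_bij (fun j _ => ω ^ j) (by simp) ?_ ?_ (by simp)
  · intro a ha b hb h
    rw [Finset.mem_range] at ha hb
    exact pow_injOn_Iio_orderOf (by simpa [ho] using ha) (by simpa [ho] using hb) h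
  · intro χ _
    obtain ⟨j, rfl⟩ := hω χ
    refine ⟨j % (Fintype.card F - 1), Finset.mem_range.mpr (Nat.mod_lt _ hpos), ?_⟩
    rw [← ho, pow_mod_orderOf]

lemma hd_pow_eq_one {ω : MulChar F ℂ} (hω : ∀ χ : MulChar F ℂ, ∃ j : ℕ, χ = ω ^ j)
    {m s : ℕ} (hm : 0 < m) (hms : m * s = Fintype.card F - 1) {ψ : MulChar F ℂ} (h : ψ ^ m = 1) :
    ∃ i < m, ψ = (ω ^ s) ^ i := by
  obtain ⟨j, rfl⟩ := hω ψ
  rw [← pow_mul, ← orderOf_dvd_iff_pow_eq_one, hd_orderOf hω, ← hms, mul_comm j m] at h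
  obtain ⟨k, rfl⟩ := Nat.dvd_of_mul_dvd_mul_left hm h
  refine ⟨k % m, Nat.mod_lt _ hm, ?_⟩
  have : (ω ^ s) ^ m = 1 := by
    rw [← pow_mul, mul_comm, hms, ← hd_orderOf hω, pow_orderOf_eq_one]
  rw [pow_mul]
  conv_lhs => rw [← Nat.mod_add_div k m, pow_add, pow_mul _ m, this, one_pow, mul_one]

lemma hd_exists_root (h : Fintype.card F % 6 = 1) : ∃ ζ : F, ζ ^ 2 + ζ + 1 = 0 := by
  have : Fact (Nat.Prime 3) := ⟨by norm_num⟩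
  have hd : 3 ∣ Fintype.card Fˣ := by
    rw [Fintype.card_units]; omega
  obtain ⟨u, hu⟩ := exists_prime_orderOf_dvd_card 3 hd
  refine ⟨u, ?_⟩
  have h3 : (u : F) ^ 3 = 1 := by
    have := pow_orderOf_eq_one u
    rw [hu] at this
    rw [← Units.val_pow_eq_pow_val, this, Units.val_one]
  have h1 : (u : F) - 1 ≠ 0 := by
    intro h
    have : u = 1 := by ext; simpa [sub_eq_zero] using h
    rw [this, orderOf_one] at hu
    omega
  apply mul_left_cancel₀ h1
  linear_combination h3

/-- Hasse-Davenport product formula for `m = 6`. -/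
lemma hd_six {e : AddChar F ℂ} (he : e.IsPrimitive) (he1 : e ≠ 1) {t : ℕ}
    (ht : 6 * t = Fintype.card F - 1) (hq6 : Fintype.card F % 6 = 1)
    {ω : MulChar F ℂ} (hω : ∀ χ : MulChar F ℂ, ∃ j : ℕ, χ = ω ^ j)
    {w : MulChar F ℂ} (hw : w = ω ^ t) (χ : MulChar F ℂ) :
    (χ ^ 6) 6 * (gaussSum χ e * gaussSum (χ * w) e * gaussSum (χ * w ^ 2) e *
      (gaussSum (χ * w ^ 3) e * gaussSum (χ * w ^ 4) e * gaussSum (χ * w ^ 5) e)) =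
      gaussSum (χ ^ 6) e * Fintype.card F * gaussSum (w ^ 3) e ^ 3 := by
  have hw6 : w ^ 6 = 1 := by
    rw [hw, ← pow_mul, mul_comm, ht, ← hd_orderOf hω, pow_orderOf_eq_one]
  have ht0 : 0 < t := by have := Fintype.one_lt_card (α := F); omega
  have hqF : (6 : F) * t + 1 = 0 := by
    have h : ((6 * t + 1 : ℕ) : F) = 0 := by
      rw [ht, Nat.sub_add_cancel Fintype.card_pos]; exact FiniteField.cast_card_eq_zero F
    exact_mod_cast h
  have h2 : (2 : F) ≠ 0 := by
    intro h; exact one_ne_zero (α := F) (by linear_combination hqF - 3 * t * h)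
  have h3 : (3 : F) ≠ 0 := by
    intro h; exact one_ne_zero (α := F) (by linear_combination hqF - 2 * t * h)
  obtain ⟨ζ, hζ⟩ := hd_exists_root hq6
  have hwne : ∀ i, 0 < i → i < 6 → w ^ i ≠ 1 := by
    intro i hi0 hi6 h
    rw [hw, ← pow_mul, ← orderOf_dvd_iff_pow_eq_one, hd_orderOf hω, ← ht, mul_comm t i] at h
    have := Nat.le_of_dvd hi0 (Nat.dvd_of_mul_dvd_mul_right ht0 h)
    omega
  have H2 := hd_two he he1 h2 (hwne 3 (by norm_num) (by norm_num)) (by rw [← pow_mul]; exact hw6)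
    (fun ψ hψ => by
      obtain ⟨i, hi, h⟩ := hd_pow_eq_one hω (m := 2) (s := t * 3) (by norm_num) (by omega) hψ
      rw [pow_mul, ← hw] at h
      interval_cases i
      · left; simpa using h
      · right; simpa using h)
  have H3 := hd_three he he1 h3 ζ hζ (hwne 2 (by norm_num) (by norm_num)) (by rw [← pow_mul]; exact hw6)
    (fun ψ hψ => by
      obtain ⟨i, hi, h⟩ := hd_pow_eq_one hω (m := 3) (s := t * 2) (by norm_num) (by omega) hψ
      rw [pow_mul, ← hw] at h
      interval_cases i
      · left; simpa using h
      · right; left; simpa using h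
      · right; right; exact h)
  have a0 := H2 χ
  have a1 := H2 (χ * w)
  have a2 := H2 (χ * w ^ 2)
  have b := H3 (χ ^ 2)
  rw [mul_assoc, ← pow_succ', mul_pow] at a1
  rw [mul_assoc, ← pow_add, mul_pow] at a2
  rw [← pow_mul χ] at b
  norm_num at a1 a2 b
  have w4 : w 4 ^ 3 = 1 := by
    have : (4 : F) = 2 ^ 2 := by norm_num
    rw [this, map_pow, ← pow_mul, ← MulChar.pow_apply' _ (by norm_num), hw6,
      MulChar.one_apply (isUnit_iff_ne_zero.mpr h2)]
  have h66 : (χ ^ 6) 6 = χ 4 ^ 3 * χ 27 ^ 2 := by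
    rw [MulChar.pow_apply' _ (by norm_num), ← map_pow, ← map_pow, ← map_pow, ← map_mul]
    congr 1; norm_num
  rw [MulChar.pow_apply' _ (by norm_num)] at a2 b
  rw [h66]
  set g0 := gaussSum χ e
  set g1 := gaussSum (χ * w) e
  set g2 := gaussSum (χ * w ^ 2) e
  set g3 := gaussSum (χ * w ^ 3) e
  set g4 := gaussSum (χ * w ^ 4) e
  set g5 := gaussSum (χ * w ^ 5) e
  calc _ = χ 27 ^ 2 * (χ 4 * (g0 * g3)) * (χ 4 * w 4 * (g1 * g4)) * (χ 4 * w 4 ^ 2 * (g2 * g5)) := by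
        linear_combination (- χ 4 ^ 3 * χ 27 ^ 2 * g0 * g1 * g2 * g3 * g4 * g5) * w4
    _ = _ := by
        rw [a0, a1, a2]
        linear_combination gaussSum (w ^ 3) e ^ 3 * b

lemma hd_gBinom {e : AddChar F ℂ} (he : e.IsPrimitive) {A B η : MulChar F ℂ} (hη : η ≠ 1)
    (h : A * B⁻¹ = η) :
    gBinom F A B = B (-1) / (Fintype.card F : ℂ) *
      (gaussSum A e * gaussSum B⁻¹ e / gaussSum η e) := by
  rw [gBinom, hd_jacobiS, jacobiSum_eq_gaussSum_mul_gaussSum_div_gaussSum (by simp) (by rwa [h]) he, h]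

noncomputable def hdH (b : MulChar F ℂ) : ℂ := if b = 1 then 1 else (Fintype.card F : ℂ)

lemma hd_inv {e : AddChar F ℂ} (he : e.IsPrimitive) (he1 : e ≠ 1) (b : MulChar F ℂ) :
    gaussSum b⁻¹ e = b (-1) * hdH b / gaussSum b e := by
  rw [eq_div_iff (hd_gauss_ne_zero he he1 b), hdH]
  split_ifs with h
  · subst h; rw [inv_one, gaussSum_one_left he1, MulChar.one_apply (by simp)]; norm_num
  · rw [mul_comm, hd_gauss_inv he h]

noncomputable def hdS (e : AddChar F ℂ) (w : MulChar F ℂ) (lam : F) (χ : MulChar F ℂ) : ℂ :=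
  (gaussSum χ e * gaussSum (χ * w) e * gaussSum (χ * w ^ 2) e) ^ 2 / gaussSum (χ ^ 6) e *
    (χ ^ 6) (6 * lam)

noncomputable def hdP (e : AddChar F ℂ) (w : MulChar F ℂ) (χ : MulChar F ℂ) : ℂ :=
  (gaussSum χ e * gaussSum (χ * w) e * gaussSum (χ * w ^ 2) e) ^ 2

/-- The term of the hypergeometric sum at `(χ w²)⁻¹`. -/
lemma hd_term {e : AddChar F ℂ} (he : e.IsPrimitive) (he1 : e ≠ 1) {t : ℕ}
    (ht : 6 * t = Fintype.card F - 1) (hq6 : Fintype.card F % 6 = 1)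
    {ω : MulChar F ℂ} (hω : ∀ χ : MulChar F ℂ, ∃ j : ℕ, χ = ω ^ j)
    {w : MulChar F ℂ} (hw : w = ω ^ t) (hw6 : w ^ 6 = 1) (hw3 : w ^ 3 ≠ 1)
    (lam : F) (hlam : lam ≠ 0) (χ : MulChar F ℂ) :
    (Fintype.card F : ℂ) ^ 4 * (gBinom F (w ^ 3 * (χ * w ^ 2)⁻¹) (χ * w ^ 2)⁻¹ *
      (gBinom F ((w ^ 2)⁻¹ * (χ * w ^ 2)⁻¹) (w * (χ * w ^ 2)⁻¹) *
      gBinom F (w⁻¹ * (χ * w ^ 2)⁻¹) (w ^ 2 * (χ * w ^ 2)⁻¹)) * (χ * w ^ 2)⁻¹ (lam ^ 6)⁻¹) =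
    hdS e w lam χ * (hdH (χ * w ^ 3) * hdH (χ * w ^ 4) * hdH (χ * w ^ 5)) /
      (Fintype.card F : ℂ) ^ 3 := by
  have hq0 : (Fintype.card F : ℂ) ≠ 0 := by simp
  have w5 : w⁻¹ = w ^ 5 := by rw [inv_eq_iff_mul_eq_one, ← pow_succ', hw6]
  have w33 : w ^ 3 * w ^ 3 = 1 := by rw [← pow_add, hw6]
  have w3i : (w ^ 3)⁻¹ = w ^ 3 := by rw [inv_eq_iff_mul_eq_one, w33]
  rw [hd_gBinom he hw3 (show w ^ 3 * (χ * w ^ 2)⁻¹ * ((χ * w ^ 2)⁻¹)⁻¹ = w ^ 3 by group),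
    hd_gBinom he hw3 (show (w ^ 2)⁻¹ * (χ * w ^ 2)⁻¹ * (w * (χ * w ^ 2)⁻¹)⁻¹ = w ^ 3 by
      rw [← w3i]; generalize (χ * w ^ 2)⁻¹ = v
      rw [mul_inv w v, pow_succ w 2, mul_inv (w ^ 2) w, mul_mul_mul_comm, mul_inv_cancel, mul_one]),
    hd_gBinom he hw3 (show w⁻¹ * (χ * w ^ 2)⁻¹ * (w ^ 2 * (χ * w ^ 2)⁻¹)⁻¹ = w ^ 3 by
      rw [← w3i]; generalize (χ * w ^ 2)⁻¹ = v
      rw [mul_inv (w ^ 2) v, pow_succ' w 2, mul_inv w (w ^ 2), mul_mul_mul_comm, mul_inv_cancel, mul_one])]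
  have c1 : w ^ 3 * (χ * w ^ 2)⁻¹ = (χ * w ^ 5)⁻¹ := by
    rw [eq_inv_iff_mul_eq_one, show χ * w ^ 5 = w ^ 3 * (χ * w ^ 2) by
      rw [mul_left_comm, ← pow_add], mul_mul_mul_comm, w33, inv_mul_cancel, mul_one]
  have c2 : (w ^ 2)⁻¹ * (χ * w ^ 2)⁻¹ = (χ * w ^ 4)⁻¹ := by
    rw [← mul_inv, mul_left_comm, ← pow_add]
  have c3 : (w * (χ * w ^ 2)⁻¹)⁻¹ = χ * w := by
    rw [mul_inv, inv_inv, inv_mul_eq_iff_eq_mul, mul_left_comm, pow_two]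
  have c4 : w⁻¹ * (χ * w ^ 2)⁻¹ = (χ * w ^ 3)⁻¹ := by
    rw [← mul_inv, mul_left_comm, ← pow_succ']
  have c5 : (w ^ 2 * (χ * w ^ 2)⁻¹)⁻¹ = χ := by
    rw [mul_inv, inv_inv, inv_mul_eq_iff_eq_mul, mul_comm]
  rw [c1, c2, c3, c4, c5, inv_inv, hd_inv he he1, hd_inv he he1, hd_inv he he1]
  have hneg : ∀ ψ : MulChar F ℂ, ψ (-1) ^ 2 = 1 := by
    intro ψ; rw [← map_pow]; norm_num
  have hinvneg : ∀ ψ : MulChar F ℂ, ψ⁻¹ (-1) = ψ (-1) := by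
    intro ψ; rw [MulChar.inv_apply', inv_neg, inv_one]
  have hG : gaussSum (w ^ 3) e ^ 2 = w (-1) * Fintype.card F := by
    have := hd_gauss_inv he hw3
    rw [w3i] at this
    rw [pow_two, this, MulChar.pow_apply' _ (by norm_num)]
    linear_combination (w (-1) * Fintype.card F) * hneg w
  have hlamv : (χ * w ^ 2)⁻¹ (lam ^ 6)⁻¹ = χ lam ^ 6 := by
    have : w lam ^ 6 = 1 := by
      rw [← MulChar.pow_apply' _ (by norm_num), hw6, MulChar.one_apply (isUnit_iff_ne_zero.mpr hlam)]
    rw [MulChar.inv_apply', inv_inv, MulChar.mul_apply, map_pow, MulChar.pow_apply' _ (by norm_num),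
      map_pow, this]; norm_num
  have hS := hd_six he he1 ht hq6 hω hw χ
  rw [hlamv, hdS]
  simp only [MulChar.mul_apply, hinvneg, map_mul, MulChar.pow_apply' _ (show 2 ≠ 0 by norm_num),
    MulChar.pow_apply' _ (show 3 ≠ 0 by norm_num), MulChar.pow_apply' _ (show 4 ≠ 0 by norm_num),
    MulChar.pow_apply' _ (show 5 ≠ 0 by norm_num), MulChar.pow_apply' χ (show 6 ≠ 0 by norm_num)] at hS ⊢
  have hx := hneg χ
  have hy := hneg w
  have n0 := hd_gauss_ne_zero he he1 χ
  have n1 := hd_gauss_ne_zero he he1 (χ * w)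
  have n2 := hd_gauss_ne_zero he he1 (χ * w ^ 2)
  have n3 := hd_gauss_ne_zero he he1 (χ * w ^ 3)
  have n4 := hd_gauss_ne_zero he he1 (χ * w ^ 4)
  have n5 := hd_gauss_ne_zero he he1 (χ * w ^ 5)
  have n6 := hd_gauss_ne_zero he he1 (χ ^ 6)
  have nG := hd_gauss_ne_zero he he1 (w ^ 3)
  generalize gaussSum χ e = g0 at *
  generalize gaussSum (χ * w) e = g1 at *
  generalize gaussSum (χ * w ^ 2) e = g2 at *
  generalize gaussSum (χ * w ^ 3) e = g3 at *
  generalize gaussSum (χ * w ^ 4) e = g4 at *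
  generalize gaussSum (χ * w ^ 5) e = g5 at *
  generalize gaussSum (χ ^ 6) e = g6 at *
  generalize gaussSum (w ^ 3) e = G at *
  generalize χ (-1) = x at *
  generalize w (-1) = y at *
  generalize hdH (χ * w ^ 3) = h3 at *
  generalize hdH (χ * w ^ 4) = h4 at *
  generalize hdH (χ * w ^ 5) = h5 at *
  generalize χ lam = L at *
  generalize χ 6 = s at *
  generalize (Fintype.card F : ℂ) = q at *
  have e1 : g6 = s ^ 6 * (g0 * g1 * g2 * (g3 * g4 * g5)) / (q * G ^ 3) := by
    rw [eq_div_iff (by positivity)]; linear_combination -hS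
  have ns : s ≠ 0 := by
    rintro rfl; apply n6; rw [e1]; simp
  have hx6 : x ^ 6 = 1 := by
    calc x ^ 6 = (x ^ 2) ^ 3 := by ring
      _ = 1 := by rw [hx]; norm_num
  have hy20 : ∀ n, y ^ (2 * n) = 1 := by
    intro n; rw [pow_mul, hy, one_pow]
  have hG6 : G ^ 6 = y * q ^ 3 := by
    calc G ^ 6 = (G ^ 2) ^ 3 := by ring
      _ = y * q ^ 3 := by rw [hG]; linear_combination (y * q ^ 3) * hy
  rw [e1]
  have lhs : q ^ 4 * (x * y ^ 2 / q * (x * y ^ 5 * h5 / g5 * g2 / G) *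
      (y * (x * y ^ 2) / q * (x * y ^ 4 * h4 / g4 * g1 / G) *
      (y ^ 2 * (x * y ^ 2) / q * (x * y ^ 3 * h3 / g3 * g0 / G))) * L ^ 6) =
      x ^ 6 * y ^ (2 * 10) * y * (q * g0 * g1 * g2 * h3 * h4 * h5 * L ^ 6 / (g3 * g4 * g5 * G ^ 3)) := by
    field_simp
    ring
  rw [lhs, hx6, hy20]
  field_simp
  linear_combination (-h3 * h4 * h5 * L ^ 6) * hG6

lemma hd_case {e : AddChar F ℂ} (he1 : e ≠ 1) {w : MulChar F ℂ} (hw6 : w ^ 6 = 1)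
    (hwne : ∀ i, 0 < i → i < 6 → w ^ i ≠ 1) (lam : F) (h6 : 6 * lam ≠ 0) (χ : MulChar F ℂ) :
    hdS e w lam χ * (hdH (χ * w ^ 3) * hdH (χ * w ^ 4) * hdH (χ * w ^ 5)) /
      (Fintype.card F : ℂ) ^ 3 = hdS e w lam χ +
      ((if χ = w ^ 1 then ((Fintype.card F : ℂ) - 1) / Fintype.card F * hdP e w (w ^ 1) else 0) +
      (if χ = w ^ 2 then ((Fintype.card F : ℂ) - 1) / Fintype.card F * hdP e w (w ^ 2) else 0) +
      (if χ = w ^ 3 then ((Fintype.card F : ℂ) - 1) / Fintype.card F * hdP e w (w ^ 3) else 0)) := by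
  have hq0 : (Fintype.card F : ℂ) ≠ 0 := by simp
  have key : ∀ a b : ℕ, a + b = 6 → (χ * w ^ b = 1 ↔ χ = w ^ a) := by
    intro a b hab
    have hi : (w ^ b)⁻¹ = w ^ a := by
      rw [inv_eq_iff_mul_eq_one, ← pow_add, add_comm, hab, hw6]
    rw [mul_eq_one_iff_eq_inv, hi]
  have hS : ∀ k, χ = w ^ k → hdS e w lam χ = - hdP e w χ := by
    intro k hk
    have : χ ^ 6 = 1 := by rw [hk, ← pow_mul, mul_comm, pow_mul, hw6, one_pow]
    rw [hdS, hdP, this, gaussSum_one_left he1, MulChar.one_apply (isUnit_iff_ne_zero.mpr h6)]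
    ring
  have hne : ∀ a b : ℕ, a < b → b < 6 → w ^ a ≠ w ^ b := by
    intro a b hab hb h
    obtain ⟨c, rfl⟩ := Nat.exists_eq_add_of_lt hab
    rw [add_assoc, pow_add] at h
    exact hwne (c + 1) (by omega) (by omega) (mul_eq_left.mp h.symm)
  have n12 := hne 1 2 (by norm_num) (by norm_num)
  have n13 := hne 1 3 (by norm_num) (by norm_num)
  have n23 := hne 2 3 (by norm_num) (by norm_num)
  rw [hdH, hdH, hdH]
  simp only [key 3 3 rfl, key 2 4 rfl, key 1 5 rfl]
  by_cases h1 : χ = w ^ 1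
  · have h2 : χ ≠ w ^ 2 := by rw [h1]; exact n12
    have h3 : χ ≠ w ^ 3 := by rw [h1]; exact n13
    rw [hS 1 h1, if_neg h3, if_neg h2, if_pos h1, if_pos h1, if_neg h2, if_neg h3, h1]
    field_simp
    ring
  by_cases h2 : χ = w ^ 2
  · have h3 : χ ≠ w ^ 3 := by rw [h2]; exact n23
    rw [hS 2 h2, if_neg h3, if_neg h1, if_pos h2, if_pos h2, if_neg h1, if_neg h3, h2]
    field_simp
    ring
  by_cases h3 : χ = w ^ 3
  · rw [hS 3 h3, if_neg h2, if_neg h1, if_pos h3, if_pos h3, if_neg h1, if_neg h2, h3]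
    field_simp
    ring
  rw [if_neg h1, if_neg h2, if_neg h3, if_neg h1, if_neg h2, if_neg h3]
  field_simp
  ring

end Main

/-- The contribution of the class of `w = (0,0,1,1,2,2)` in Koblitz's formula. -/
theorem class_001122 (p e q t : ℕ) [Fact p.Prime] (F : Type) [Field F] [Fintype F]
    [Algebra (ZMod p) F]
    (he : 0 < e) (hq : q = Fintype.card F) (hqe : q = p ^ e) (hmod : q % 6 = 1)
    (ht : t = (q - 1) / 6)
    (ω : MulChar F ℂ) (hω : ∀ χ : MulChar F ℂ, ∃ j : ℕ, χ = ω ^ j)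
    (ω₆ ω₃ ω₂ : MulChar F ℂ)
    (hω₆ : ω₆ = ω ^ t) (hω₃ : ω₃ = ω ^ (2 * t)) (hω₂ : ω₂ = ω ^ (3 * t))
    (lam : F) (hlam : lam ≠ 0) (hlam6 : lam ^ 6 ≠ 1) :
    (∑ k ∈ Finset.range 6, NqW p F ω 6 (fun i => (![0,0,1,1,2,2] : Fin 6 → ZMod 6) i + (k : ZMod 6))) +
      SW p F ω 6 (fun _ => 1) (![0,0,1,1,2,2] : Fin 6 → ZMod 6) lam =
      (q : ℂ) ^ 3 * greeneF F ω ![ω₂, ω₃⁻¹, ω₆⁻¹] ![ω₆, ω₃] (lam ^ 6)⁻¹ := by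
  subst hq
  have hcard : 1 < Fintype.card F := Fintype.one_lt_card
  have ht6 : 6 * t = Fintype.card F - 1 := by omega
  have ht0 : 0 < t := by omega
  have he1 := hdAdd_ne (F := F) p
  have hep := AddChar.IsPrimitive.of_ne_one he1
  have hw6 : ω₆ ^ 6 = 1 := by
    rw [hω₆, ← pow_mul, mul_comm, ht6, ← hd_orderOf hω, pow_orderOf_eq_one]
  have hwne : ∀ i, 0 < i → i < 6 → ω₆ ^ i ≠ 1 := by
    intro i hi0 hi6 h
    rw [hω₆, ← pow_mul, ← orderOf_dvd_iff_pow_eq_one, hd_orderOf hω, ← ht6, mul_comm t i] at h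
    have := Nat.le_of_dvd hi0 (Nat.dvd_of_mul_dvd_mul_right ht0 h)
    omega
  have h3w : ω₃ = ω₆ ^ 2 := by rw [hω₃, hω₆, mul_comm, pow_mul]
  have h2w : ω₂ = ω₆ ^ 3 := by rw [hω₂, hω₆, mul_comm, pow_mul]
  have hqF : (6 : F) * t + 1 = 0 := by
    have h : ((6 * t + 1 : ℕ) : F) = 0 := by
      rw [ht6, Nat.sub_add_cancel Fintype.card_pos]; exact FiniteField.cast_card_eq_zero F
    exact_mod_cast h
  have h6 : (6 : F) * lam ≠ 0 := by
    refine mul_ne_zero ?_ hlam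
    intro h; exact one_ne_zero (α := F) (by linear_combination hqF - t * h)
  have hq0 : (Fintype.card F : ℂ) ≠ 0 := by simp
  have hq1 : (Fintype.card F : ℂ) - 1 ≠ 0 := by
    rw [sub_ne_zero]; exact_mod_cast hcard.ne'
  have hSW : SW p F ω 6 (fun _ => 1) (![0,0,1,1,2,2] : Fin 6 → ZMod 6) lam =
      ((Fintype.card F : ℂ) - 1)⁻¹ * ∑ χ, hdS (hdAdd p F) ω₆ lam χ := by
    rw [SW, ← hd_sum_range hω]
    congr 1
    refine Finset.sum_congr rfl fun j _ => ?_
    have v0 : (0 : ZMod 6).val = 0 := rfl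
    have v1 : (1 : ZMod 6).val = 1 := rfl
    have v2 : (2 : ZMod 6).val = 2 := rfl
    have e0 : ω ^ (0 * t + 1 * j) = ω ^ j := by simp
    have e1 : ω ^ (1 * t + 1 * j) = ω ^ j * ω₆ := by
      rw [hω₆, ← pow_add, one_mul, one_mul, add_comm]
    have e2 : ω ^ (2 * t + 1 * j) = ω ^ j * ω₆ ^ 2 := by
      rw [hω₆, ← pow_mul, ← pow_add, one_mul, add_comm, mul_comm]
    have e6 : ω ^ (6 * j) = (ω ^ j) ^ 6 := by rw [← pow_mul, mul_comm]
    rw [Fin.prod_univ_six, ← ht, hdS, e6]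
    simp only [Matrix.cons_val, v0, v1, v2, e0, e1, e2, hd_gaussChar, Nat.cast_ofNat]
    ring
  have hN : (∑ k ∈ Finset.range 6, NqW p F ω 6
      (fun i => (![0,0,1,1,2,2] : Fin 6 → ZMod 6) i + (k : ZMod 6))) =
      1 / (Fintype.card F : ℂ) * (hdP (hdAdd p F) ω₆ (ω₆ ^ 1) + hdP (hdAdd p F) ω₆ (ω₆ ^ 2) +
        hdP (hdAdd p F) ω₆ (ω₆ ^ 3)) := by
    have v1 : (1 : ZMod 6).val = 1 := rfl
    have ep : ∀ n, ω ^ (n * t) = ω₆ ^ n := by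
      intro n; rw [hω₆, ← pow_mul, mul_comm]
    have z : ∀ k : ZMod 6, k = 0 ∨ k = 4 ∨ k = 5 → NqW p F ω 6
        (fun i => (![0,0,1,1,2,2] : Fin 6 → ZMod 6) i + k) = 0 := by
      rintro k (rfl | rfl | rfl) <;> rw [NqW, if_neg (by decide), if_neg (by decide)]
    have nz : ∀ k : ℕ, k = 1 ∨ k = 2 ∨ k = 3 → NqW p F ω 6
        (fun i => (![0,0,1,1,2,2] : Fin 6 → ZMod 6) i + (k : ZMod 6)) =
        1 / (Fintype.card F : ℂ) * hdP (hdAdd p F) ω₆ (ω₆ ^ k) := by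
      intro k hk
      have a0 : ((0 : ZMod 6) + k).val = k := by rcases hk with rfl | rfl | rfl <;> rfl
      have a1 : ((1 : ZMod 6) + k).val = k + 1 := by rcases hk with rfl | rfl | rfl <;> rfl
      have a2 : ((2 : ZMod 6) + k).val = k + 2 := by rcases hk with rfl | rfl | rfl <;> rfl
      rw [NqW, if_neg (by rcases hk with rfl | rfl | rfl <;> decide),
        if_pos (by rcases hk with rfl | rfl | rfl <;> decide), Fin.prod_univ_six, ← ht]
      simp only [Matrix.cons_val, a0, a1, a2, ep, hd_gaussChar]
      rw [hdP, ← pow_succ, ← pow_add]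
      ring
    rw [Finset.sum_range_succ, Finset.sum_range_succ, Finset.sum_range_succ, Finset.sum_range_succ,
      Finset.sum_range_succ, Finset.sum_range_succ, Finset.sum_range_zero,
      nz 1 (by simp), nz 2 (by simp), nz 3 (by simp), z _ (by simp), z _ (by right; left; rfl),
      z _ (by right; right; rfl)]
    ring
  have hR : (Fintype.card F : ℂ) ^ 3 * greeneF F ω ![ω₂, ω₃⁻¹, ω₆⁻¹] ![ω₆, ω₃] (lam ^ 6)⁻¹ =
      ((Fintype.card F : ℂ) - 1)⁻¹ * ∑ χ, hdS (hdAdd p F) ω₆ lam χ *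
        (hdH (χ * ω₆ ^ 3) * hdH (χ * ω₆ ^ 4) * hdH (χ * ω₆ ^ 5)) / (Fintype.card F : ℂ) ^ 3 := by
    have hterm := fun χ => hd_term hep he1 ht6 hmod hω hω₆ hw6
      (hwne 3 (by norm_num) (by norm_num)) lam hlam χ
    rw [← Finset.sum_congr rfl (fun χ _ => hterm χ), ← Finset.mul_sum]
    rw [greeneF, h2w, h3w]
    simp only [Fin.prod_univ_two]
    have hsum := (hd_sum_range hω (fun v => gBinom F (ω₆ ^ 3 * v) v *
      (gBinom F ((ω₆ ^ 2)⁻¹ * v) (ω₆ * v) * gBinom F (ω₆⁻¹ * v) (ω₆ ^ 2 * v)) * v (lam ^ 6)⁻¹))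
    refine (congrArg (fun s => (Fintype.card F : ℂ) ^ 3 *
      ((Fintype.card F : ℂ) / ((Fintype.card F : ℂ) - 1) * s)) hsum).trans ?_
    rw [← Equiv.sum_comp ((Equiv.mulRight (ω₆ ^ 2)).trans (Equiv.inv (MulChar F ℂ)))]
    simp only [Equiv.trans_apply, Equiv.coe_mulRight, Equiv.inv_apply]
    ring
  rw [hR, hN, hSW, Finset.sum_congr rfl (fun χ _ => hd_case he1 hw6 hwne lam h6 χ),
    Finset.sum_add_distrib, Finset.sum_add_distrib, Finset.sum_add_distrib,
    Finset.sum_ite_eq' , Finset.sum_ite_eq', Finset.sum_ite_eq']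
  simp only [Finset.mem_univ, if_true]
  field_simp
  ring
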